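/- Let α ∈ (0,1) and λ₁ > 0, and define E_{α,α}(x) := ∑_{k=0}^∞ x^k · (Γ(α k + α))⁻¹ for x ∈ ℝ. Then there exists C > 0, depending only on α and λ₁, such that for every sequence (λ_k)_{k∈ℕ} of reals with λ_k ≥ λ₁ for all k, every real sequence (a_k)_{k∈ℕ} with ∑_k a_k² < ∞, and every t ≥ 1, one has ∑_{k} λ_k² · (t^{α-1} E_{α,α}(-λ_k t^α))² · a_k² ≤ C t^{-2(α+1)} ∑_{k} a_k². -/

import Mathlib

open Real

open Complex MeasureTheory Set Filter Topology in
/-- The Gamma integral with a complex scaling parameter in the right half-plane. -/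
lemma integral_cpow_mul_cexp_neg_mul_Ioi {a : ℝ} (ha : 0 < a) {z : ℂ} (hz : 0 < z.re) :
    ∫ t : ℝ in Ioi 0, (t : ℂ) ^ ((a : ℂ) - 1) * cexp (-(z * t)) =
      (1 / z) ^ (a : ℂ) * Complex.Gamma a := by
  have hopen : IsOpen {z : ℂ | 0 < z.re} := isOpen_lt continuous_const continuous_re
  have hconv : IsPreconnected {z : ℂ | 0 < z.re} :=
    (convex_halfSpace_re_gt 0).isPreconnected
  have hcont : ∀ b : ℝ, ContinuousOn (fun t : ℝ => (t : ℂ) ^ ((b : ℂ))) (Ioi 0) := fun b t ht =>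
    (Complex.continuousAt_ofReal_cpow_const t b (Or.inr (ne_of_gt ht))).continuousWithinAt
  have hmeas : ∀ w : ℂ, AEStronglyMeasurable
      (fun t : ℝ => (t : ℂ) ^ ((a : ℂ) - 1) * cexp (-(w * t))) (volume.restrict (Ioi 0)) := by
    intro w
    refine ContinuousOn.aestronglyMeasurable ?_ measurableSet_Ioi
    have := hcont (a - 1)
    push_cast at this
    exact this.mul (by fun_prop)
  have hnorm : ∀ w : ℂ, ∀ t ∈ Ioi (0 : ℝ),
      ‖(t : ℂ) ^ ((a : ℂ) - 1) * cexp (-(w * t))‖ = t ^ (a - 1) * Real.exp (-(w.re * t)) := by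
    intro w t ht
    rw [norm_mul, Complex.norm_cpow_eq_rpow_re_of_pos ht, Complex.norm_exp]
    simp
  have hint : ∀ (b c : ℝ), 0 < b → 0 < c → Integrable (fun t : ℝ => t ^ (b - 1) * Real.exp (-(c * t)))
      (volume.restrict (Ioi 0)) := by
    intro b c hb hc
    have := integrableOn_rpow_mul_exp_neg_mul_rpow (p := 1) (s := b - 1) (b := c) (by linarith)
      one_pos hc
    rw [← IntegrableOn]
    simpa using this
  have hdiff : DifferentiableOn ℂ
      (fun w : ℂ => ∫ t : ℝ in Ioi 0, (t : ℂ) ^ ((a : ℂ) - 1) * cexp (-(w * t)))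
      {z : ℂ | 0 < z.re} := by
    intro w hw
    have hw' : 0 < w.re := hw
    have := (hasDerivAt_integral_of_dominated_loc_of_deriv_le (μ := volume.restrict (Ioi (0 : ℝ)))
      (F := fun w (t : ℝ) => (t : ℂ) ^ ((a : ℂ) - 1) * cexp (-(w * t)))
      (F' := fun w (t : ℝ) => (t : ℂ) ^ ((a : ℂ) - 1) * (cexp (-(w * t)) * (-(1 * t)))) (x₀ := w)
      (s := {z : ℂ | w.re / 2 < z.re})
      (bound := fun t => t ^ (a + 1 - 1) * Real.exp (-(w.re / 2 * t)))
      ((isOpen_lt continuous_const continuous_re).mem_nhds (by simpa using hw'))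
      (Eventually.of_forall hmeas) ?_ ?_ ?_ (hint _ _ (by linarith) (by linarith)) ?_).2
    · exact this.differentiableAt.differentiableWithinAt
    · refine (hint a w.re ha hw').mono' (hmeas w) ?_
      exact (ae_restrict_iff' measurableSet_Ioi).2 (Eventually.of_forall fun t ht =>
        (hnorm w t ht).le)
    · refine ContinuousOn.aestronglyMeasurable ?_ measurableSet_Ioi
      have := hcont (a - 1)
      push_cast at this
      exact this.mul (by fun_prop)
    · refine (ae_restrict_iff' measurableSet_Ioi).2 (Eventually.of_forall fun t ht v hv => ?_)
      have ht' : 0 < t := ht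
      have hv' : w.re / 2 < v.re := hv
      rw [← mul_assoc, norm_mul, hnorm v t ht, show a + 1 - 1 = (a - 1) + 1 by ring,
        Real.rpow_add_one ht'.ne']
      have h1 : ‖-(1 * (t : ℂ))‖ = t := by simp [abs_of_pos ht']
      rw [h1, mul_right_comm]
      gcongr
    · refine Eventually.of_forall fun t v _ => ?_
      exact (((hasDerivAt_id v).mul_const (t : ℂ)).neg.cexp).const_mul _
  have hdiff2 : DifferentiableOn ℂ (fun w : ℂ => (1 / w) ^ (a : ℂ) * Complex.Gamma a)
      {z : ℂ | 0 < z.re} := by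
    intro w hw
    have hw' : 0 < w.re := hw
    have hw0 : w ≠ 0 := fun h => by simp [h] at hw'
    refine DifferentiableAt.differentiableWithinAt ?_
    refine ((((differentiableAt_const _).div differentiableAt_id hw0)).cpow_const ?_).mul_const _
    refine Complex.mem_slitPlane_iff.2 (Or.inl ?_)
    have := Complex.normSq_pos.2 hw0
    change 0 < (1 / w).re
    rw [one_div, Complex.inv_re]
    positivity
  refine (hdiff.analyticOnNhd hopen).eqOn_of_preconnected_of_frequently_eq
    (hdiff2.analyticOnNhd hopen) hconv (z₀ := 1) (by simp) ?_ hz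
  have hseq : Tendsto (fun n : ℕ => ((1 + 1 / ((n : ℝ) + 1) : ℝ) : ℂ)) atTop (𝓝[≠] 1) := by
    refine tendsto_nhdsWithin_iff.2 ⟨?_, Eventually.of_forall fun n => ?_⟩
    · have h := (tendsto_one_div_add_atTop_nhds_zero_nat (𝕜 := ℝ)).const_add 1
      rw [add_zero] at h
      exact_mod_cast (Complex.continuous_ofReal.tendsto 1).comp h
    · have : (0 : ℝ) < 1 / ((n : ℝ) + 1) := by positivity
      intro h
      have h' := Complex.ofReal_eq_one.1 h
      linarith
  refine hseq.frequently (Eventually.of_forall fun n => ?_).frequently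
  exact Complex.integral_cpow_mul_exp_neg_mul_Ioi (by simpa using ha) (by positivity)

/-- The ray leaving the real point `c` in the direction `-1 + i`, the upper half of a Hankel
contour. -/
noncomputable def hankelRay (c r : ℝ) : ℂ := c + r * (-1 + Complex.I)

open MeasureTheory in
/-- The integral of `e ^ s * h s` along the upper half of a Hankel contour through `c`. -/
noncomputable def hankelIntegral (h : ℂ → ℂ) (c : ℝ) : ℂ :=
  ∫ r : ℝ in Set.Ioi 0, Complex.exp (hankelRay c r) * h (hankelRay c r) * (-1 + Complex.I)

/-- Continuity on the slit plane together with boundedness away from the origin. -/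
structure SlitBounded (h : ℂ → ℂ) : Prop where
  continuousOn : ContinuousOn h Complex.slitPlane
  bounded : ∀ m > 0, ∃ M, ∀ s ∈ Complex.slitPlane, m ≤ ‖s‖ → ‖h s‖ ≤ M

lemma hankelRay_re (c r : ℝ) : (hankelRay c r).re = c - r := by
  simp [hankelRay, sub_eq_add_neg]

lemma hankelRay_im (c r : ℝ) : (hankelRay c r).im = r := by
  simp [hankelRay]

lemma hankelRay_zero (c : ℝ) : hankelRay c 0 = c := by
  simp [hankelRay]

lemma hankelRay_mem_slitPlane {c r : ℝ} (hc : 0 < c) (hr : 0 ≤ r) :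
    hankelRay c r ∈ Complex.slitPlane := by
  rw [Complex.mem_slitPlane_iff, hankelRay_re, hankelRay_im]
  rcases hr.eq_or_lt with rfl | hr
  · left; simpa using hc
  · right; exact hr.ne'

lemma half_le_norm_hankelRay (c r : ℝ) : c / 2 ≤ ‖hankelRay c r‖ := by
  refine le_of_sq_le_sq ?_ (norm_nonneg _)
  rw [← Complex.normSq_eq_norm_sq, Complex.normSq_apply, hankelRay_re, hankelRay_im]
  nlinarith [sq_nonneg (c - 2 * r)]

lemma le_norm_hankelRay (c r : ℝ) : r ≤ ‖hankelRay c r‖ := by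
  have := Complex.abs_im_le_norm (hankelRay c r)
  rw [hankelRay_im] at this
  exact (le_abs_self r).trans this

lemma norm_cexp_hankelRay (c r : ℝ) :
    ‖Complex.exp (hankelRay c r)‖ = Real.exp c * Real.exp (-r) := by
  rw [Complex.norm_exp, hankelRay_re, ← Real.exp_add, sub_eq_add_neg]

lemma norm_neg_one_add_I_le : ‖(-1 + Complex.I : ℂ)‖ ≤ 2 := by
  refine (norm_add_le _ _).trans ?_
  simp only [norm_neg, norm_one, Complex.norm_I]
  norm_num

lemma continuous_hankelRay (c : ℝ) : Continuous (hankelRay c) := by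
  unfold hankelRay
  fun_prop

lemma hasDerivAt_hankelRay (c r : ℝ) : HasDerivAt (hankelRay c) (-1 + Complex.I) r := by
  have := ((hasDerivAt_id r).ofReal_comp.mul_const (-1 + Complex.I)).const_add (c : ℂ)
  rwa [Complex.ofReal_one, one_mul] at this

lemma hasDerivAt_hankelRay_left (c r : ℝ) : HasDerivAt (fun c => hankelRay c r) 1 c := by
  exact (hasDerivAt_id c).ofReal_comp.add_const ((r : ℂ) * (-1 + Complex.I))

open MeasureTheory Set in
lemma integrable_exp_neg_Ioi (K : ℝ) :
    Integrable (fun r : ℝ => K * Real.exp (-r)) (volume.restrict (Ioi 0)) := by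
  have := integrableOn_exp_mul_Ioi (a := -1) (by norm_num) 0
  simpa using Integrable.const_mul this K

namespace SlitBounded

open MeasureTheory Set Filter Topology

variable {h h' : ℂ → ℂ}

lemma continuousOn_comp_hankelRay (hh : SlitBounded h) {c : ℝ} (hc : 0 < c) :
    ContinuousOn (fun r => h (hankelRay c r)) (Ici 0) :=
  hh.continuousOn.comp (continuous_hankelRay c).continuousOn
    fun _ hr => hankelRay_mem_slitPlane hc hr

lemma aestronglyMeasurable (hh : SlitBounded h) {c : ℝ} (hc : 0 < c) :
    AEStronglyMeasurable (fun r : ℝ =>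
      Complex.exp (hankelRay c r) * h (hankelRay c r) * (-1 + Complex.I))
      (volume.restrict (Ioi 0)) := by
  refine ContinuousOn.aestronglyMeasurable ?_ measurableSet_Ioi
  have h1 := (hh.continuousOn_comp_hankelRay hc).mono Ioi_subset_Ici_self
  have h2 := (Complex.continuous_exp.comp (continuous_hankelRay c)).continuousOn (s := Ioi 0)
  exact (h2.mul h1).mul continuousOn_const

lemma norm_le {M c r : ℝ} (hM : ‖h (hankelRay c r)‖ ≤ M) :
    ‖Complex.exp (hankelRay c r) * h (hankelRay c r) * (-1 + Complex.I)‖ ≤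
      Real.exp c * M * 2 * Real.exp (-r) := by
  have hM0 : 0 ≤ M := (norm_nonneg _).trans hM
  rw [norm_mul, norm_mul, norm_cexp_hankelRay]
  calc _ ≤ Real.exp c * Real.exp (-r) * M * 2 := by
        gcongr
        exact norm_neg_one_add_I_le
    _ = _ := by ring

lemma integrable (hh : SlitBounded h) {c : ℝ} (hc : 0 < c) :
    Integrable (fun r : ℝ =>
      Complex.exp (hankelRay c r) * h (hankelRay c r) * (-1 + Complex.I))
      (volume.restrict (Ioi 0)) := by
  obtain ⟨M, hM⟩ := hh.bounded (c / 2) (by positivity)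
  refine (integrable_exp_neg_Ioi (Real.exp c * M * 2)).mono' (hh.aestronglyMeasurable hc) ?_
  refine (ae_restrict_iff' measurableSet_Ioi).2 (Eventually.of_forall fun r hr => ?_)
  exact norm_le (hM _ (hankelRay_mem_slitPlane hc (le_of_lt hr)) (half_le_norm_hankelRay c r))

lemma add (hh : SlitBounded h) (hh' : SlitBounded h') : SlitBounded (fun s => h s + h' s) where
  continuousOn := hh.continuousOn.add hh'.continuousOn
  bounded m hm := by
    obtain ⟨M, hM⟩ := hh.bounded m hm
    obtain ⟨M', hM'⟩ := hh'.bounded m hm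
    exact ⟨M + M', fun s hs hms => norm_add_le_of_le (hM s hs hms) (hM' s hs hms)⟩

/-- Integration by parts along the ray. -/
lemma hankelIntegral_add_deriv (hh : SlitBounded h) (hh' : SlitBounded h')
    (hd : ∀ s ∈ Complex.slitPlane, HasDerivAt h (h' s) s) {c : ℝ} (hc : 0 < c) :
    hankelIntegral (fun s => h s + h' s) c = -(Complex.exp c * h c) := by
  obtain ⟨M, hM⟩ := hh.bounded (c / 2) (by positivity)
  have hder : ∀ r ∈ Ici (0 : ℝ), HasDerivAt
      (fun r => Complex.exp (hankelRay c r) * h (hankelRay c r))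
      (Complex.exp (hankelRay c r) * (h (hankelRay c r) + h' (hankelRay c r)) *
        (-1 + Complex.I)) r := by
    intro r hr
    have h1 := (hasDerivAt_hankelRay c r).cexp
    have h2 := (hd _ (hankelRay_mem_slitPlane hc hr)).comp_of_eq r (hasDerivAt_hankelRay c r) rfl
    exact (h1.mul h2).congr_deriv (by simp only [Function.comp]; ring)
  have hlim : Tendsto (fun r => Complex.exp (hankelRay c r) * h (hankelRay c r)) atTop (𝓝 0) := by
    have hexp : Tendsto (fun r : ℝ => Real.exp c * M * Real.exp (-r)) atTop (𝓝 0) := by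
      simpa using (Real.tendsto_exp_neg_atTop_nhds_zero).const_mul (Real.exp c * M)
    refine squeeze_zero_norm' ?_ hexp
    filter_upwards [eventually_ge_atTop 0] with r hr
    rw [norm_mul, norm_cexp_hankelRay]
    have := hM _ (hankelRay_mem_slitPlane hc hr) (half_le_norm_hankelRay c r)
    calc _ ≤ Real.exp c * Real.exp (-r) * M := by gcongr
      _ = _ := by ring
  have := integral_Ioi_of_hasDerivAt_of_tendsto
    (hder 0 self_mem_Ici).continuousAt.continuousWithinAt
    (fun r hr => hder r (Ioi_subset_Ici_self hr)) ((hh.add hh').integrable hc) hlim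
  rw [hankelIntegral, this, hankelRay_zero, zero_sub]

lemma hasDerivAt_hankelIntegral (hh : SlitBounded h) (hh' : SlitBounded h')
    (hd : ∀ s ∈ Complex.slitPlane, HasDerivAt h (h' s) s) {c : ℝ} (hc : 0 < c) :
    HasDerivAt (hankelIntegral h) (-(Complex.exp c * h c)) c := by
  rw [← hh.hankelIntegral_add_deriv hh' hd hc]
  obtain ⟨M, hM⟩ := (hh.add hh').bounded (c / 4) (by positivity)
  refine (hasDerivAt_integral_of_dominated_loc_of_deriv_le (μ := volume.restrict (Ioi (0 : ℝ)))
    (F := fun c r => Complex.exp (hankelRay c r) * h (hankelRay c r) * (-1 + Complex.I))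
    (F' := fun c r => Complex.exp (hankelRay c r) * (h (hankelRay c r) + h' (hankelRay c r)) *
      (-1 + Complex.I))
    (s := Ioo (c / 2) (2 * c)) (bound := fun r => Real.exp (2 * c) * M * 2 * Real.exp (-r))
    (Ioo_mem_nhds (half_lt_self hc) (by linarith)) ?_ (hh.integrable hc)
    ((hh.add hh').aestronglyMeasurable hc) ?_ (integrable_exp_neg_Ioi _) ?_).2
  · filter_upwards [Ioi_mem_nhds hc] with x hx using hh.aestronglyMeasurable hx
  · refine (ae_restrict_iff' measurableSet_Ioi).2 (Eventually.of_forall fun r hr x hx => ?_)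
    have hx0 : 0 < x := by linarith [hx.1]
    have hcx : c / 4 ≤ x / 2 := by linarith [hx.1]
    have hb := hM _ (hankelRay_mem_slitPlane hx0 (le_of_lt hr))
      (hcx.trans (half_le_norm_hankelRay x r))
    refine (norm_le (h := fun s => h s + h' s) hb).trans ?_
    have : 0 ≤ M := (norm_nonneg _).trans hb
    have := hx.2.le
    gcongr
  · refine (ae_restrict_iff' measurableSet_Ioi).2 (Eventually.of_forall fun r hr x hx => ?_)
    have hx0 : 0 < x := by linarith [hx.1]
    have h1 := (hasDerivAt_hankelRay_left x r).cexp
    have h2 := (hd _ (hankelRay_mem_slitPlane hx0 (le_of_lt hr))).comp_of_eq x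
      (hasDerivAt_hankelRay_left x r) rfl
    exact ((h1.mul h2).mul_const (-1 + Complex.I)).congr_deriv
      (by simp only [Function.comp]; ring)

/-- The imaginary part of the Hankel integral does not depend on the base point. -/
lemma im_hankelIntegral_eq (hh : SlitBounded h) (hh' : SlitBounded h')
    (hd : ∀ s ∈ Complex.slitPlane, HasDerivAt h (h' s) s) (hreal : ∀ c : ℝ, 0 < c → (h c).im = 0)
    {c c' : ℝ} (hc : 0 < c) (hc' : 0 < c') :
    (hankelIntegral h c).im = (hankelIntegral h c').im := by
  have hder : ∀ x ∈ Ioi (0 : ℝ), HasDerivAt (fun x => (hankelIntegral h x).im) 0 x := by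
    intro x hx
    have := Complex.imCLM.hasFDerivAt.comp_hasDerivAt x
      (hh.hasDerivAt_hankelIntegral hh' hd hx)
    refine this.congr_deriv ?_
    rw [Complex.imCLM_apply, Complex.neg_im, ← Complex.ofReal_exp, Complex.im_ofReal_mul,
      hreal x hx, mul_zero, neg_zero]
  exact isOpen_Ioi.is_const_of_deriv_eq_zero isPreconnected_Ioi
    (fun x hx => (hder x hx).differentiableAt.differentiableWithinAt)
    (fun x hx => (hder x hx).deriv) hc hc'

end SlitBounded

section CpowHankel

open MeasureTheory Set Filter Topology

lemma slitBounded_cpow_neg {β : ℝ} (hβ : 0 ≤ β) :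
    SlitBounded (fun s => s ^ ((-β : ℝ) : ℂ)) where
  continuousOn s hs := (continuousAt_id.cpow continuousAt_const hs).continuousWithinAt
  bounded m hm := ⟨m ^ (-β), fun s _ hms => by
    rw [Complex.norm_cpow_real]
    exact Real.rpow_le_rpow_of_nonpos hm hms (by linarith)⟩

lemma SlitBounded.const_mul {h : ℂ → ℂ} (hh : SlitBounded h) (a : ℂ) :
    SlitBounded (fun s => a * h s) where
  continuousOn := continuousOn_const.mul hh.continuousOn
  bounded m hm := by
    obtain ⟨M, hM⟩ := hh.bounded m hm
    refine ⟨‖a‖ * M, fun s hs hms => ?_⟩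
    rw [norm_mul]
    gcongr
    exact hM s hs hms

lemma hankelIntegral_const_mul (h : ℂ → ℂ) (a : ℂ) (c : ℝ) :
    hankelIntegral (fun s => a * h s) c = a * hankelIntegral h c := by
  unfold hankelIntegral
  rw [← integral_const_mul]
  congr 1
  ext r
  ring

lemma SlitBounded.hankelIntegral_add {h h' : ℂ → ℂ} (hh : SlitBounded h) (hh' : SlitBounded h')
    {c : ℝ} (hc : 0 < c) :
    hankelIntegral (fun s => h s + h' s) c = hankelIntegral h c + hankelIntegral h' c := by
  unfold hankelIntegral
  rw [← integral_add (hh.integrable hc) (hh'.integrable hc)]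
  congr 1
  ext r
  ring

lemma hasDerivAt_cpow_neg (β : ℝ) {s : ℂ} (hs : s ∈ Complex.slitPlane) :
    HasDerivAt (fun s : ℂ => s ^ ((-β : ℝ) : ℂ))
      (((-β : ℝ) : ℂ) * s ^ ((-(β + 1) : ℝ) : ℂ)) s := by
  refine ((hasDerivAt_id s).cpow_const (c := ((-β : ℝ) : ℂ)) hs).congr_deriv ?_
  rw [mul_one, id, show ((-β : ℝ) : ℂ) - 1 = ((-(β + 1) : ℝ) : ℂ) by push_cast; ring]

lemma im_ofReal_cpow {c : ℝ} (hc : 0 < c) (β : ℝ) : ((c : ℂ) ^ ((β : ℝ) : ℂ)).im = 0 := by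
  rw [← Complex.ofReal_cpow hc.le, Complex.ofReal_im]

lemma im_hankelIntegral_cpow_neg_eq {β : ℝ} (hβ : 0 ≤ β) {c c' : ℝ} (hc : 0 < c) (hc' : 0 < c') :
    (hankelIntegral (fun s => s ^ ((-β : ℝ) : ℂ)) c).im =
      (hankelIntegral (fun s => s ^ ((-β : ℝ) : ℂ)) c').im :=
  (slitBounded_cpow_neg hβ).im_hankelIntegral_eq
    ((slitBounded_cpow_neg (by linarith : 0 ≤ β + 1)).const_mul ((-β : ℝ) : ℂ))
    (fun _ hs => hasDerivAt_cpow_neg β hs) (fun _ hx => im_ofReal_cpow hx _) hc hc'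

lemma im_hankelIntegral_cpow_neg_add_one {β : ℝ} (hβ : 0 < β) {c : ℝ} (hc : 0 < c) :
    (hankelIntegral (fun s => s ^ ((-(β + 1) : ℝ) : ℂ)) c).im =
      (hankelIntegral (fun s => s ^ ((-β : ℝ) : ℂ)) c).im / β := by
  have h0 := slitBounded_cpow_neg hβ.le
  have h1 := (slitBounded_cpow_neg (by linarith : 0 ≤ β + 1))
  have h2 := h0.hankelIntegral_add_deriv (h1.const_mul ((-β : ℝ) : ℂ))
    (fun _ hs => hasDerivAt_cpow_neg β hs) hc
  rw [h0.hankelIntegral_add (h1.const_mul _) hc, hankelIntegral_const_mul] at h2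
  have h3 := congrArg Complex.im h2
  rw [Complex.add_im, Complex.im_ofReal_mul, Complex.neg_im, ← Complex.ofReal_exp,
    Complex.im_ofReal_mul, im_ofReal_cpow hc] at h3
  field_simp
  linarith

lemma hankelIntegral_cpow_neg_zero {β : ℝ} (hβ : β < 1) :
    hankelIntegral (fun s => s ^ ((-β : ℝ) : ℂ)) 0 =
      Complex.exp ((1 - β : ℝ) * (π * Complex.I)) * Real.Gamma (1 - β) := by
  have hd : (-1 + Complex.I : ℂ) ≠ 0 := fun h => by simpa using congrArg Complex.im h
  have hd' : (1 - Complex.I : ℂ) ≠ 0 := fun h => by simpa using congrArg Complex.im h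
  have hG := integral_cpow_mul_cexp_neg_mul_Ioi (a := 1 - β) (by linarith)
    (z := 1 - Complex.I) (by simp)
  have harg : (1 - Complex.I : ℂ).arg = (-1 + Complex.I : ℂ).arg - π := by
    rw [← Complex.arg_neg_eq_arg_sub_pi_of_im_pos (by simp)]
    ring_nf
  have hlog : Complex.log (-1 + Complex.I) = Complex.log (1 - Complex.I) + π * Complex.I := by
    unfold Complex.log
    rw [harg, show (-1 + Complex.I : ℂ) = -(1 - Complex.I) by ring, norm_neg]
    push_cast
    ring
  have hargne : (1 - Complex.I : ℂ).arg ≠ π := by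
    rw [harg]
    have := Complex.arg_le_pi (-1 + Complex.I)
    have := Real.pi_pos
    intro h
    linarith
  have hphase : (-1 + Complex.I : ℂ) ^ ((-β : ℝ) : ℂ) * (-1 + Complex.I) *
      (1 / (1 - Complex.I)) ^ ((1 - β : ℝ) : ℂ) = Complex.exp ((1 - β : ℝ) * (π * Complex.I)) := by
    have h1 : (-1 + Complex.I : ℂ) ^ ((-β : ℝ) : ℂ) * (-1 + Complex.I) =
        (-1 + Complex.I) ^ ((1 - β : ℝ) : ℂ) := by
      rw [show ((1 - β : ℝ) : ℂ) = ((-β : ℝ) : ℂ) + 1 by push_cast; ring, Complex.cpow_add _ _ hd,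
        Complex.cpow_one]
    rw [h1, one_div, Complex.cpow_def_of_ne_zero hd, Complex.cpow_def_of_ne_zero (inv_ne_zero hd'),
      Complex.log_inv _ hargne, hlog, ← Complex.exp_add]
    congr 1
    ring
  rw [← hphase, mul_assoc, ← Complex.Gamma_ofReal, ← hG, ← integral_const_mul]
  refine setIntegral_congr_fun measurableSet_Ioi fun r hr => ?_
  have hr0 : (0 : ℝ) ≤ r := le_of_lt hr
  have hray : hankelRay 0 r = (r : ℂ) * (-1 + Complex.I) := by simp [hankelRay]
  have hmul : ((r : ℂ) * (-1 + Complex.I)) ^ ((-β : ℝ) : ℂ) =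
      (r : ℂ) ^ ((-β : ℝ) : ℂ) * (-1 + Complex.I) ^ ((-β : ℝ) : ℂ) := by
    have hrne : (r : ℂ) ≠ 0 := Complex.ofReal_ne_zero.2 (ne_of_gt hr)
    rw [Complex.cpow_def_of_ne_zero (mul_ne_zero hrne hd), Complex.log_ofReal_mul hr hd,
      Complex.cpow_def_of_ne_zero hrne, Complex.cpow_def_of_ne_zero hd, ← Complex.exp_add,
      Complex.ofReal_log hr0, add_mul]
  simp only [hray]
  rw [hmul, show ((1 - β : ℝ) : ℂ) - 1 = ((-β : ℝ) : ℂ) by push_cast; ring,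
    show -((1 - Complex.I) * (r : ℂ)) = (r : ℂ) * (-1 + Complex.I) by ring]
  ring

lemma im_hankelIntegral_cpow_neg_of_lt_one {β : ℝ} (hβ : 0 < β) (hβ1 : β < 1) {c : ℝ}
    (hc : 0 < c) :
    (hankelIntegral (fun s => s ^ ((-β : ℝ) : ℂ)) c).im = π * (Real.Gamma β)⁻¹ := by
  have hlim : Tendsto (fun c => hankelIntegral (fun s => s ^ ((-β : ℝ) : ℂ)) c) (𝓝[>] 0)
      (𝓝 (hankelIntegral (fun s => s ^ ((-β : ℝ) : ℂ)) 0)) := by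
    have hint : Integrable (fun r : ℝ => Real.exp 1 * 2 * (r ^ (-β) * Real.exp (-r)))
        (volume.restrict (Ioi 0)) := by
      have := integrableOn_rpow_mul_exp_neg_mul_rpow (p := 1) (s := -β) (b := 1) (by linarith)
        one_pos one_pos
      refine Integrable.const_mul ?_ _
      rw [← IntegrableOn]
      simpa using this
    refine tendsto_integral_filter_of_dominated_convergence _ ?_ ?_ hint ?_
    · filter_upwards [self_mem_nhdsWithin] with x hx
        using (slitBounded_cpow_neg hβ.le).aestronglyMeasurable hx
    · filter_upwards [self_mem_nhdsWithin, Ioo_mem_nhdsGT one_pos] with x hx hx1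
      refine (ae_restrict_iff' measurableSet_Ioi).2 (Eventually.of_forall fun r hr => ?_)
      have hb : ‖hankelRay x r ^ ((-β : ℝ) : ℂ)‖ ≤ r ^ (-β) := by
        rw [Complex.norm_cpow_real]
        exact Real.rpow_le_rpow_of_nonpos hr (le_norm_hankelRay x r) (by linarith)
      have hr' : (0 : ℝ) < r := hr
      refine (SlitBounded.norm_le (h := fun s => s ^ ((-β : ℝ) : ℂ)) hb).trans ?_
      have := hx1.2.le
      calc Real.exp x * r ^ (-β) * 2 * Real.exp (-r)
          ≤ Real.exp 1 * r ^ (-β) * 2 * Real.exp (-r) := by gcongr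
        _ = _ := by ring
    · refine (ae_restrict_iff' measurableSet_Ioi).2 (Eventually.of_forall fun r hr => ?_)
      have hs : hankelRay 0 r ∈ Complex.slitPlane := by
        rw [Complex.mem_slitPlane_iff, hankelRay_im]
        exact Or.inr (ne_of_gt hr)
      have hray : ContinuousAt (fun x => hankelRay x r) 0 :=
        (hasDerivAt_hankelRay_left 0 r).continuousAt
      have : ContinuousAt (fun x => Complex.exp (hankelRay x r) *
          hankelRay x r ^ ((-β : ℝ) : ℂ) * (-1 + Complex.I)) 0 :=
        (hray.cexp.mul (hray.cpow continuousAt_const hs)).mul continuousAt_const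
      exact this.tendsto.mono_left nhdsWithin_le_nhds
  have hlim' := (Complex.continuous_im.tendsto _).comp hlim
  have hconst : Tendsto (Complex.im ∘ fun c => hankelIntegral (fun s => s ^ ((-β : ℝ) : ℂ)) c)
      (𝓝[>] 0) (𝓝 (hankelIntegral (fun s => s ^ ((-β : ℝ) : ℂ)) c).im) := by
    refine tendsto_const_nhds.congr' ?_
    filter_upwards [self_mem_nhdsWithin] with x hx
      using im_hankelIntegral_cpow_neg_eq hβ.le hc hx
  rw [tendsto_nhds_unique hconst hlim', hankelIntegral_cpow_neg_zero hβ1, Complex.im_mul_ofReal,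
    show ((1 - β : ℝ) : ℂ) * (π * Complex.I) = ((π * (1 - β) : ℝ) : ℂ) * Complex.I by
      push_cast; ring, Complex.exp_ofReal_mul_I_im,
    show π * (1 - β) = π - π * β by ring, Real.sin_pi_sub]
  have hsin : 0 < Real.sin (π * β) :=
    Real.sin_pos_of_pos_of_lt_pi (by positivity) (by nlinarith [Real.pi_pos])
  have hrefl := Real.Gamma_mul_Gamma_one_sub β
  have := Real.Gamma_pos_of_pos hβ
  rw [eq_div_iff hsin.ne'] at hrefl
  rw [← div_eq_mul_inv, eq_div_iff this.ne']
  linarith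

lemma continuousAt_hankelIntegral_cpow_neg :
    ContinuousAt (fun β : ℝ => hankelIntegral (fun s => s ^ ((-β : ℝ) : ℂ)) 2) 1 := by
  refine continuousAt_of_dominated (bound := fun r => Real.exp 2 * 1 * 2 * Real.exp (-r)) ?_ ?_
    (integrable_exp_neg_Ioi _) ?_
  · filter_upwards [Ioi_mem_nhds one_pos] with β hβ
      using (slitBounded_cpow_neg (le_of_lt hβ)).aestronglyMeasurable two_pos
  · filter_upwards [Ioi_mem_nhds one_pos] with β hβ
    refine Eventually.of_forall fun r => ?_
    refine SlitBounded.norm_le (h := fun s => s ^ ((-β : ℝ) : ℂ)) ?_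
    rw [Complex.norm_cpow_real]
    have h1 := half_le_norm_hankelRay 2 r
    have hβ' : 0 < β := hβ
    exact Real.rpow_le_one_of_one_le_of_nonpos (by linarith) (by linarith)
  · refine Eventually.of_forall fun r => ?_
    have hne : hankelRay 2 r ≠ 0 := by
      have := half_le_norm_hankelRay 2 r
      exact norm_pos_iff.1 (by linarith)
    have : ContinuousAt (fun β : ℝ => hankelRay 2 r ^ ((-β : ℝ) : ℂ)) 1 :=
      ContinuousAt.const_cpow (by fun_prop) (Or.inl hne)
    exact (continuousAt_const.mul this).mul continuousAt_const

/-- **Hankel's formula** for the reciprocal Gamma function on the positive reals. -/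
lemma im_hankelIntegral_cpow_neg {β : ℝ} (hβ : 0 < β) {c : ℝ} (hc : 0 < c) :
    (hankelIntegral (fun s => s ^ ((-β : ℝ) : ℂ)) c).im = π * (Real.Gamma β)⁻¹ := by
  have hone : (hankelIntegral (fun s => s ^ ((-1 : ℝ) : ℂ)) c).im = π * (Real.Gamma 1)⁻¹ := by
    rw [im_hankelIntegral_cpow_neg_eq zero_le_one hc two_pos]
    have h1 : Tendsto (fun β : ℝ => (hankelIntegral (fun s => s ^ ((-β : ℝ) : ℂ)) 2).im) (𝓝[<] 1)
        (𝓝 (hankelIntegral (fun s => s ^ ((-1 : ℝ) : ℂ)) 2).im) :=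
      (Complex.continuous_im.continuousAt.comp
        continuousAt_hankelIntegral_cpow_neg).tendsto.mono_left nhdsWithin_le_nhds
    have h2 : Tendsto (fun β : ℝ => π * (Real.Gamma β)⁻¹) (𝓝[<] 1) (𝓝 (π * (Real.Gamma 1)⁻¹)) := by
      have hG : ContinuousAt Real.Gamma 1 := (Real.differentiableAt_Gamma fun m h => by
        have : (0 : ℝ) ≤ m := m.cast_nonneg
        linarith).continuousAt
      exact ((hG.inv₀ (Real.Gamma_pos_of_pos one_pos).ne').const_mul π).tendsto.mono_left
        nhdsWithin_le_nhds
    refine tendsto_nhds_unique h1 (h2.congr' ?_)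
    filter_upwards [Ioo_mem_nhdsLT one_pos] with β hβ
      using (im_hankelIntegral_cpow_neg_of_lt_one hβ.1 hβ.2 two_pos).symm
  have key : ∀ n : ℕ, ∀ β : ℝ, 0 < β → β ≤ n + 1 →
      (hankelIntegral (fun s => s ^ ((-β : ℝ) : ℂ)) c).im = π * (Real.Gamma β)⁻¹ := by
    intro n
    induction n with
    | zero =>
      intro β hβ hβ1
      rw [Nat.cast_zero, zero_add] at hβ1
      rcases hβ1.eq_or_lt with rfl | hlt
      · exact hone
      · exact im_hankelIntegral_cpow_neg_of_lt_one hβ hlt hc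
    | succ n ih =>
      intro β hβ hβn
      by_cases hβ1 : β ≤ 1
      · exact ih β hβ (by linarith [(n.cast_nonneg : (0 : ℝ) ≤ n)])
      · have hpos : 0 < β - 1 := by linarith
        have := im_hankelIntegral_cpow_neg_add_one hpos hc
        have hG := Real.Gamma_add_one hpos.ne'
        rw [sub_add_cancel] at this hG
        rw [this, ih (β - 1) hpos (by push_cast at hβn; linarith), hG, mul_inv]
        ring
  obtain ⟨n, hn⟩ := exists_nat_ge β
  exact key n β hβ (by linarith)

end CpowHankel

section MittagLeffler

open MeasureTheory Set Filter Topology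

lemma sin_mul_le_norm_cpow_add {α : ℝ} (hα : α ∈ Ioo (0 : ℝ) 1) {x : ℝ} (hx : 0 < x) (s : ℂ) :
    Real.sin (α * π) * x ≤ ‖s ^ (α : ℂ) + x‖ := by
  refine le_of_sq_le_sq ?_ (norm_nonneg _)
  have hre := Complex.cpow_ofReal_re s α
  have him := Complex.cpow_ofReal_im s α
  set ρ := ‖s‖ ^ α
  have hρ : 0 ≤ ρ := Real.rpow_nonneg (norm_nonneg _) _
  have hcos : Real.cos (α * π) ≤ Real.cos (s.arg * α) := by
    rw [← Real.cos_abs (s.arg * α), abs_mul, abs_of_pos hα.1, mul_comm]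
    refine Real.cos_le_cos_of_nonneg_of_le_pi (by have := hα.1; positivity) ?_ ?_
    · nlinarith [hα.2, Real.pi_pos]
    · exact mul_le_mul_of_nonneg_right (Complex.abs_arg_le_pi s) hα.1.le
  rw [← Complex.normSq_eq_norm_sq, Complex.normSq_apply, Complex.add_re, Complex.add_im, hre, him,
    Complex.ofReal_re, Complex.ofReal_im]
  have h1 := Real.sin_sq_add_cos_sq (s.arg * α)
  have h2 := Real.sin_sq_add_cos_sq (α * π)
  have h3 : 0 ≤ ρ * x * (Real.cos (s.arg * α) - Real.cos (α * π)) :=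
    mul_nonneg (by positivity) (by linarith)
  have h4 : (ρ * Real.cos (s.arg * α) + x) * (ρ * Real.cos (s.arg * α) + x) +
      (ρ * Real.sin (s.arg * α) + 0) * (ρ * Real.sin (s.arg * α) + 0) =
      ρ ^ 2 + 2 * (ρ * x * Real.cos (s.arg * α)) + x ^ 2 := by
    linear_combination ρ ^ 2 * h1
  have h5 : (Real.sin (α * π) * x) ^ 2 = x ^ 2 - (Real.cos (α * π) * x) ^ 2 := by
    linear_combination x ^ 2 * h2
  rw [h4, h5]
  nlinarith [sq_nonneg (ρ + Real.cos (α * π) * x)]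

lemma sin_mul_pi_pos {α : ℝ} (hα : α ∈ Ioo (0 : ℝ) 1) : 0 < Real.sin (α * π) :=
  Real.sin_pos_of_pos_of_lt_pi (mul_pos hα.1 Real.pi_pos) (by nlinarith [hα.2, Real.pi_pos])

lemma cpow_add_ne_zero {α : ℝ} (hα : α ∈ Ioo (0 : ℝ) 1) {x : ℝ} (hx : 0 < x) (s : ℂ) :
    s ^ (α : ℂ) + x ≠ 0 :=
  norm_pos_iff.1 ((mul_pos (sin_mul_pi_pos hα) hx).trans_le (sin_mul_le_norm_cpow_add hα hx s))

lemma norm_inv_cpow_add_le {α : ℝ} (hα : α ∈ Ioo (0 : ℝ) 1) {x : ℝ} (hx : 0 < x) (s : ℂ) :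
    ‖(s ^ (α : ℂ) + x)⁻¹‖ ≤ (Real.sin (α * π) * x)⁻¹ := by
  rw [norm_inv]
  exact inv_anti₀ (mul_pos (sin_mul_pi_pos hα) hx) (sin_mul_le_norm_cpow_add hα hx s)

lemma slitBounded_inv_cpow_add {α : ℝ} (hα : α ∈ Ioo (0 : ℝ) 1) {x : ℝ} (hx : 0 < x) :
    SlitBounded (fun s => (s ^ (α : ℂ) + x)⁻¹) where
  continuousOn s hs := (((continuousAt_id.cpow continuousAt_const hs).add
    continuousAt_const).inv₀ (cpow_add_ne_zero hα hx s)).continuousWithinAt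
  bounded _ _ := ⟨_, fun s _ _ => norm_inv_cpow_add_le hα hx s⟩

lemma SlitBounded.mul {h h' : ℂ → ℂ} (hh : SlitBounded h) (hh' : SlitBounded h') :
    SlitBounded (fun s => h s * h' s) where
  continuousOn := hh.continuousOn.mul hh'.continuousOn
  bounded m hm := by
    obtain ⟨M, hM⟩ := hh.bounded m hm
    obtain ⟨M', hM'⟩ := hh'.bounded m hm
    refine ⟨M * M', fun s hs hms => ?_⟩
    rw [norm_mul]
    have h1 := hM s hs hms
    have h2 := hM' s hs hms
    have := (norm_nonneg _).trans h1
    gcongr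

lemma im_hankelIntegral_inv_cpow_add_eq {α : ℝ} (hα : α ∈ Ioo (0 : ℝ) 1) {x : ℝ} (hx : 0 < x)
    {c c' : ℝ} (hc : 0 < c) (hc' : 0 < c') :
    (hankelIntegral (fun s => (s ^ (α : ℂ) + x)⁻¹) c).im =
      (hankelIntegral (fun s => (s ^ (α : ℂ) + x)⁻¹) c').im := by
  have hh := slitBounded_inv_cpow_add hα hx
  have hh' := ((slitBounded_cpow_neg (β := 1 - α) (by linarith [hα.2])).mul
    (hh.mul hh)).const_mul (-α)
  refine hh.im_hankelIntegral_eq hh' (fun s hs => ?_) (fun y hy => ?_) hc hc'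
  · refine ((((hasDerivAt_id s).cpow_const (c := (α : ℂ)) hs).add_const (x : ℂ)).fun_inv
      (cpow_add_ne_zero hα hx s)).congr_deriv ?_
    rw [show (α : ℂ) - 1 = ((-(1 - α) : ℝ) : ℂ) by push_cast; ring]
    simp only [id]
    field_simp
  · rw [← Complex.ofReal_cpow hy.le, ← Complex.ofReal_add, ← Complex.ofReal_inv,
      Complex.ofReal_im]

/-- The Mittag-Leffler function `E_{α,α}` on the negative axis as a Hankel integral. -/
lemma tsum_mittagLeffler_eq {α : ℝ} (hα : α ∈ Ioo (0 : ℝ) 1) {x : ℝ} (hx : 0 < x) :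
    ∑' k : ℕ, (-x) ^ k * (Real.Gamma (α * k + α))⁻¹ =
      π⁻¹ * (hankelIntegral (fun s => (s ^ (α : ℂ) + x)⁻¹) 1).im := by
  have hα0 := hα.1
  set m : ℝ := (2 * x) ^ (1 / α) with hm
  have hm0 : 0 < m := by positivity
  have hmα : m ^ α = 2 * x := by
    rw [hm, ← Real.rpow_mul (by positivity), one_div, inv_mul_cancel₀ hα0.ne', Real.rpow_one]
  have hc : 0 < 2 * m := by positivity
  have hexp : ∀ k : ℕ, 0 < α * k + α := fun k => by positivity
  have hpow : ∀ (k : ℕ) (s : ℂ), s ≠ 0 → ((-x : ℝ) : ℂ) ^ k * s ^ ((-(α * k + α) : ℝ) : ℂ) =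
      s ^ ((-α : ℝ) : ℂ) * (-x * s ^ ((-α : ℝ) : ℂ)) ^ k := by
    intro k s hs
    rw [show ((-(α * k + α) : ℝ) : ℂ) = ((-α : ℝ) : ℂ) + k * ((-α : ℝ) : ℂ) by push_cast; ring,
      Complex.cpow_add _ _ hs, Complex.cpow_nat_mul, mul_pow]
    push_cast
    ring
  have hsb : ∀ k : ℕ, SlitBounded
      (fun s => ((-x : ℝ) : ℂ) ^ k * s ^ ((-(α * k + α) : ℝ) : ℂ)) := fun k =>
    (slitBounded_cpow_neg (hexp k).le).const_mul _
  have hmle : ∀ r, m ≤ ‖hankelRay (2 * m) r‖ := fun r => by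
    have := half_le_norm_hankelRay (2 * m) r
    linarith
  have hne : ∀ r, hankelRay (2 * m) r ≠ 0 := fun r => norm_pos_iff.1 (hm0.trans_le (hmle r))
  have hα_le : ∀ r, ‖hankelRay (2 * m) r ^ ((-α : ℝ) : ℂ)‖ ≤ (2 * x)⁻¹ := fun r => by
    rw [Complex.norm_cpow_real, ← hmα, ← Real.rpow_neg hm0.le]
    exact Real.rpow_le_rpow_of_nonpos hm0 (hmle r) (by linarith)
  have hratio : ∀ r, ‖-x * hankelRay (2 * m) r ^ ((-α : ℝ) : ℂ)‖ ≤ 1 / 2 := fun r => by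
    rw [norm_mul, norm_neg, Complex.norm_of_nonneg hx.le]
    calc x * _ ≤ x * (2 * x)⁻¹ := by gcongr; exact hα_le r
      _ = 1 / 2 := by field_simp
  have hbound : ∀ (k : ℕ) (r : ℝ), ‖((-x : ℝ) : ℂ) ^ k *
      hankelRay (2 * m) r ^ ((-(α * k + α) : ℝ) : ℂ)‖ ≤ (2 * x)⁻¹ * (1 / 2) ^ k := fun k r => by
    rw [hpow k _ (hne r), norm_mul, norm_pow]
    gcongr
    exacts [hα_le r, hratio r]
  have hsum : HasSum
      (fun k : ℕ => hankelIntegral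
        (fun s => ((-x : ℝ) : ℂ) ^ k * s ^ ((-(α * k + α) : ℝ) : ℂ)) (2 * m))
      (hankelIntegral (fun s => (s ^ (α : ℂ) + x)⁻¹) (2 * m)) := by
    have heq : hankelIntegral (fun s => (s ^ (α : ℂ) + x)⁻¹) (2 * m) =
        ∫ r in Ioi (0 : ℝ), ∑' k : ℕ, Complex.exp (hankelRay (2 * m) r) *
          (((-x : ℝ) : ℂ) ^ k * hankelRay (2 * m) r ^ ((-(α * k + α) : ℝ) : ℂ)) *
            (-1 + Complex.I) := by
      unfold hankelIntegral
      congr 1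
      ext r
      rw [tsum_mul_right, tsum_mul_left]
      congr 2
      have hne0 := cpow_add_ne_zero hα hx (hankelRay (2 * m) r)
      have hs0 : hankelRay (2 * m) r ^ (α : ℂ) ≠ 0 := by
        rw [Complex.cpow_def_of_ne_zero (hne r)]
        exact Complex.exp_ne_zero _
      rw [tsum_congr fun k => hpow k _ (hne r), tsum_mul_left,
        tsum_geometric_of_norm_lt_one ((hratio r).trans_lt (by norm_num)), Complex.ofReal_neg,
        Complex.cpow_neg]
      have hrw : 1 - -(x : ℂ) * (hankelRay (2 * m) r ^ (α : ℂ))⁻¹ =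
          (hankelRay (2 * m) r ^ (α : ℂ) + x) * (hankelRay (2 * m) r ^ (α : ℂ))⁻¹ := by
        field_simp
        ring
      rw [hrw, mul_inv, inv_inv]
      field_simp
    rw [heq]
    refine hasSum_integral_of_summable_integral_norm (fun k : ℕ => (hsb k).integrable hc) ?_
    · refine Summable.of_nonneg_of_le (fun k => integral_nonneg fun r => norm_nonneg _) (fun k => ?_)
        ((summable_geometric_of_lt_one (r := (1 / 2 : ℝ)) (by norm_num) (by norm_num)).mul_left
          (∫ r in Ioi (0 : ℝ), Real.exp (2 * m) * (2 * x)⁻¹ * 2 * Real.exp (-r)))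
      rw [← integral_mul_const]
      refine integral_mono ((hsb k).integrable hc).norm
        ((integrable_exp_neg_Ioi _).mul_const _) fun r => ?_
      refine (SlitBounded.norm_le
        (h := fun s => ((-x : ℝ) : ℂ) ^ k * s ^ ((-(α * k + α) : ℝ) : ℂ)) (hbound k r)).trans_eq ?_
      ring
  have him := Complex.hasSum_im hsum
  rw [im_hankelIntegral_inv_cpow_add_eq hα hx one_pos hc, ← (him.mul_left π⁻¹).tsum_eq]
  refine tsum_congr fun k => ?_
  rw [hankelIntegral_const_mul, ← Complex.ofReal_pow, Complex.im_ofReal_mul,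
    im_hankelIntegral_cpow_neg (hexp k) hc]
  field_simp

/-- Quadratic decay of `E_{α,α}` on the negative axis. -/
lemma exists_abs_mittagLeffler_le {α : ℝ} (hα : α ∈ Ioo (0 : ℝ) 1) :
    ∃ C > 0, ∀ x : ℝ, 0 < x →
      |∑' k : ℕ, (-x) ^ k * (Real.Gamma (α * k + α))⁻¹| ≤ C / x ^ 2 := by
  have hκ := sin_mul_pi_pos hα
  set κ := Real.sin (α * π)
  have hint : Integrable (fun r : ℝ => (2 + 2 * r) * Real.exp (-r)) (volume.restrict (Ioi 0)) := by
    have h1 := integrableOn_rpow_mul_exp_neg_mul_rpow (p := 1) (s := 1) (b := 1) (by norm_num)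
      one_pos one_pos
    have h2 : Integrable (fun r : ℝ => r * Real.exp (-r)) (volume.restrict (Ioi 0)) := by
      rw [← IntegrableOn]
      simpa using h1
    refine ((integrable_exp_neg_Ioi 2).add (h2.const_mul 2)).congr (Eventually.of_forall fun r => ?_)
    simp only [Pi.add_apply]
    ring
  set B := ∫ r in Ioi (0 : ℝ), (2 + 2 * r) * Real.exp (-r)
  have hB : 0 ≤ B := setIntegral_nonneg measurableSet_Ioi fun r hr => by
    have : (0 : ℝ) < r := hr
    positivity
  refine ⟨π⁻¹ * (Real.exp 1 * 2 * κ⁻¹ * B) + 1, by positivity, fun x hx => ?_⟩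
  rw [tsum_mittagLeffler_eq hα hx, abs_mul, abs_of_pos (inv_pos.2 Real.pi_pos)]
  have hone : SlitBounded fun _ => ((x⁻¹ : ℝ) : ℂ) :=
    ⟨continuousOn_const, fun m _ => ⟨_, fun s _ _ => le_rfl⟩⟩
  have hzero : SlitBounded fun _ => (0 : ℂ) :=
    ⟨continuousOn_const, fun m _ => ⟨_, fun s _ _ => le_rfl⟩⟩
  have hres := slitBounded_inv_cpow_add hα hx
  have hJone : (hankelIntegral (fun _ => ((x⁻¹ : ℝ) : ℂ)) 1).im = 0 := by
    have := hone.hankelIntegral_add_deriv hzero (fun s _ => hasDerivAt_const s _) one_pos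
    simp only [add_zero] at this
    rw [this, Complex.neg_im, ← Complex.ofReal_exp, Complex.im_ofReal_mul, Complex.ofReal_im]
    simp
  have hsplit : hankelIntegral (fun s => (s ^ (α : ℂ) + x)⁻¹) 1 =
      hankelIntegral (fun _ => ((x⁻¹ : ℝ) : ℂ)) 1 +
        hankelIntegral (fun s => -((x⁻¹ : ℝ) : ℂ) * (s ^ (α : ℂ) * (s ^ (α : ℂ) + x)⁻¹)) 1 := by
    have hrem : (fun s : ℂ => -((x⁻¹ : ℝ) : ℂ) * (s ^ (α : ℂ) * (s ^ (α : ℂ) + x)⁻¹)) =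
        fun s : ℂ => (s ^ (α : ℂ) + x)⁻¹ + (-1) * ((x⁻¹ : ℝ) : ℂ) := by
      ext s
      have := cpow_add_ne_zero hα hx s
      have hx' : (x : ℂ) ≠ 0 := Complex.ofReal_ne_zero.2 hx.ne'
      push_cast
      field_simp
      ring
    rw [hrem, hres.hankelIntegral_add (hone.const_mul (-1)) one_pos, hankelIntegral_const_mul]
    ring
  have hJrem : ‖hankelIntegral (fun s => -((x⁻¹ : ℝ) : ℂ) * (s ^ (α : ℂ) * (s ^ (α : ℂ) + x)⁻¹)) 1‖
      ≤ Real.exp 1 * 2 * κ⁻¹ * B / x ^ 2 := by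
    have h := norm_integral_le_of_norm_le (μ := volume.restrict (Ioi 0))
      (f := fun r : ℝ => Complex.exp (hankelRay 1 r) *
        (-((x⁻¹ : ℝ) : ℂ) * (hankelRay 1 r ^ (α : ℂ) * (hankelRay 1 r ^ (α : ℂ) + x)⁻¹)) *
          (-1 + Complex.I))
      (hint.const_mul (Real.exp 1 * 2 * κ⁻¹ / x ^ 2)) ?_
    · refine h.trans_eq ?_
      rw [integral_const_mul]
      ring
    · refine (ae_restrict_iff' measurableSet_Ioi).2 (Eventually.of_forall fun r hr => ?_)
      have hr' : (0 : ℝ) < r := hr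
      have hs : ‖hankelRay 1 r‖ ≤ 1 + 2 * r := by
        refine (norm_add_le _ _).trans ?_
        rw [norm_mul, Complex.norm_of_nonneg hr'.le, Complex.ofReal_one, norm_one]
        nlinarith [norm_neg_one_add_I_le]
      have hsα : ‖hankelRay 1 r ^ (α : ℂ)‖ ≤ 2 + 2 * r := by
        rw [Complex.norm_cpow_real]
        calc ‖hankelRay 1 r‖ ^ α ≤ (1 + 2 * r) ^ α :=
              Real.rpow_le_rpow (norm_nonneg _) hs hα.1.le
          _ ≤ (1 + 2 * r) ^ (1 : ℝ) :=
              Real.rpow_le_rpow_of_exponent_le (by linarith) hα.2.le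
          _ ≤ 2 + 2 * r := by rw [Real.rpow_one]; linarith
      refine (SlitBounded.norm_le (M := x⁻¹ * ((2 + 2 * r) * (κ * x)⁻¹))
        (h := fun s => -((x⁻¹ : ℝ) : ℂ) * (s ^ (α : ℂ) * (s ^ (α : ℂ) + x)⁻¹)) ?_).trans_eq ?_
      · rw [norm_mul, norm_mul, norm_neg, Complex.norm_of_nonneg (inv_pos.2 hx).le]
        gcongr
        exact norm_inv_cpow_add_le hα hx _
      · field_simp
  rw [hsplit, Complex.add_im, hJone, zero_add]
  have := (Complex.abs_im_le_norm _).trans hJrem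
  calc _ ≤ π⁻¹ * (Real.exp 1 * 2 * κ⁻¹ * B / x ^ 2) := by gcongr
    _ ≤ _ := by
      rw [← mul_div_assoc]
      gcongr
      linarith

end MittagLeffler

/-- Large-time weighted summed bound via `E_{α,α}`: there is `C > 0`
(depending only on `α, λ₁`) such that for every sequence `λ_k ≥ λ₁`, every
`(a_k)` with `∑ a_k² < ∞` and every `t ≥ 1`,
`∑_k λ_k² (t^{α-1} E_{α,α}(-λ_k t^α))² a_k² ≤ C t^{-2(α+1)} ∑_k a_k²`. -/
theorem stmt14 (α : ℝ) (hα : α ∈ Set.Ioo (0 : ℝ) 1) (lam1 : ℝ) (hlam1 : 0 < lam1)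
    (E : ℝ → ℝ) (hE : ∀ x : ℝ, E x = ∑' k : ℕ, x ^ k * (Real.Gamma (α * k + α))⁻¹) :
    ∃ C > 0, ∀ lam : ℕ → ℝ, (∀ k, lam1 ≤ lam k) →
      ∀ a : ℕ → ℝ, Summable (fun k => (a k) ^ 2) →
      ∀ t : ℝ, 1 ≤ t →
        ∑' k : ℕ, (lam k) ^ 2 * (t ^ (α - 1) * E (-(lam k * t ^ α))) ^ 2 * (a k) ^ 2 ≤
          C * t ^ (-2 * (α + 1)) * ∑' k : ℕ, (a k) ^ 2 := by
  obtain ⟨C, hC, hdecay⟩ := exists_abs_mittagLeffler_le hα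
  refine ⟨C ^ 2 / lam1 ^ 2, by positivity, fun lam hlam a ha t ht => ?_⟩
  have ht0 : 0 < t := by linarith
  have hterm : ∀ k, (lam k) ^ 2 * (t ^ (α - 1) * E (-(lam k * t ^ α))) ^ 2 * (a k) ^ 2 ≤
      C ^ 2 / lam1 ^ 2 * t ^ (-2 * (α + 1)) * (a k) ^ 2 := by
    intro k
    have hl : 0 < lam k := hlam1.trans_le (hlam k)
    have hT : 0 < t ^ α := Real.rpow_pos_of_pos ht0 α
    refine mul_le_mul_of_nonneg_right ?_ (sq_nonneg _)
    have hEk : |E (-(lam k * t ^ α))| ≤ C / (lam k * t ^ α) ^ 2 := by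
      rw [hE]
      exact hdecay _ (mul_pos hl hT)
    have hEk2 : E (-(lam k * t ^ α)) ^ 2 ≤ (C / (lam k * t ^ α) ^ 2) ^ 2 := by
      rw [← sq_abs]
      gcongr
    have hpow : t ^ (-2 * (α + 1)) = (t ^ (α - 1)) ^ 2 / (t ^ α) ^ 4 := by
      rw [← Real.rpow_natCast, ← Real.rpow_natCast, ← Real.rpow_mul ht0.le, ← Real.rpow_mul ht0.le,
        ← Real.rpow_sub ht0]
      congr 1
      push_cast
      ring
    calc (lam k) ^ 2 * (t ^ (α - 1) * E (-(lam k * t ^ α))) ^ 2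
        = (lam k) ^ 2 * (t ^ (α - 1)) ^ 2 * E (-(lam k * t ^ α)) ^ 2 := by ring
      _ ≤ (lam k) ^ 2 * (t ^ (α - 1)) ^ 2 * (C / (lam k * t ^ α) ^ 2) ^ 2 := by gcongr
      _ = C ^ 2 / (lam k) ^ 2 * t ^ (-2 * (α + 1)) := by
        rw [hpow]
        field_simp
      _ ≤ C ^ 2 / lam1 ^ 2 * t ^ (-2 * (α + 1)) := by
        have := hlam k
        gcongr
  rw [← tsum_mul_left]
  have hsum := ha.mul_left (C ^ 2 / lam1 ^ 2 * t ^ (-2 * (α + 1)))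
  exact (Summable.of_nonneg_of_le (fun k => by positivity) hterm hsum).tsum_le_tsum hterm hsum
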